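/- Let d ≥ 1 and m ≥ 1 be integers, K > 0 and 0 < ε ≤ K. Let c : ℝᵈ → ℝᵈ be m times continuously differentiable with |∂^γ c^i(x)| ≤ ε for all x, all 1 ≤ i ≤ d and all multi-indices γ with |γ| ≤ m, and suppose |det(𝕀 + θ·Dc(x))| ≥ K⁻¹ for all x ∈ ℝᵈ and θ ∈ [0,1]. Then there exists a constant N depending only on m, d and K such that for every (m+1) times continuously differentiable, compactly supported function u : ℝᵈ → ℝ: Σ_{|α| ≤ m} ∫_{ℝᵈ} | ∂^α( u(x + c(x)) − u(x) ) |² dx ≤ N ε² Σ_{|ζ| ≤ m+1} ∫_{ℝᵈ} |∂^ζ u(x)|² dx. -/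

import Mathlib

open MeasureTheory Finset
open scoped ENNReal

/-- Partial derivative in direction `i`. -/
noncomputable def pd {d : ℕ} (i : Fin d) (f : EuclideanSpace ℝ (Fin d) → ℝ) :
    EuclideanSpace ℝ (Fin d) → ℝ :=
  fun x => fderiv ℝ f x (EuclideanSpace.single i 1)

/-- Multi-index partial derivative `∂^ζ`. -/
noncomputable def mpd {d : ℕ} (ζ : Fin d → ℕ) (f : EuclideanSpace ℝ (Fin d) → ℝ) :
    EuclideanSpace ℝ (Fin d) → ℝ :=
  (List.finRange d).foldr (fun i g => (pd i)^[ζ i] g) f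

/-- Jacobian matrix of a map `ℝᵈ → ℝᵈ`. -/
noncomputable def jac {d : ℕ} (c : EuclideanSpace ℝ (Fin d) → EuclideanSpace ℝ (Fin d))
    (x : EuclideanSpace ℝ (Fin d)) : Matrix (Fin d) (Fin d) ℝ :=
  Matrix.of fun i j => fderiv ℝ (fun y => c y i) x (EuclideanSpace.single j 1)

/-- The finite set of multi-indices `ζ ∈ ℕᵈ` with `|ζ| ≤ n`. -/
def midx (d n : ℕ) : Finset (Fin d → ℕ) :=
  (Finset.univ.image (fun f : Fin d → Fin (n + 1) => fun i => (f i : ℕ))).filter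
    (fun ζ => ∑ i, ζ i ≤ n)

lemma ContDiff.of_nat_le {E : Type*} [NormedAddCommGroup E] [NormedSpace ℝ E] {f : E → ℝ}
    {a b : ℕ} (hf : ContDiff ℝ (b : WithTop ℕ∞) f) (h : a ≤ b) :
    ContDiff ℝ (a : WithTop ℕ∞) f :=
  hf.of_le (by exact_mod_cast h)

lemma contDiff_pd {d : ℕ} {n : ℕ} {f : EuclideanSpace ℝ (Fin d) → ℝ} (i : Fin d)
    (hf : ContDiff ℝ ((n + 1 : ℕ) : WithTop ℕ∞) f) : ContDiff ℝ (n : WithTop ℕ∞) (pd i f) := by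
  unfold pd
  exact (hf.fderiv_right (by push_cast; exact le_rfl)).clm_apply contDiff_const

lemma contDiff_iterate_pd {d : ℕ} {f : EuclideanSpace ℝ (Fin d) → ℝ} (i : Fin d) (k n : ℕ)
    (hf : ContDiff ℝ ((n + k : ℕ) : WithTop ℕ∞) f) :
    ContDiff ℝ (n : WithTop ℕ∞) ((pd i)^[k] f) := by
  induction k generalizing n with
  | zero => simpa using hf
  | succ k ih =>
    rw [Function.iterate_succ_apply']
    exact contDiff_pd i (ih (n + 1) (hf.of_nat_le (by omega)))

lemma pd_comm {d : ℕ} {f : EuclideanSpace ℝ (Fin d) → ℝ} (i j : Fin d)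
    (hf : ContDiff ℝ ((2 : ℕ) : WithTop ℕ∞) f) : pd i (pd j f) = pd j (pd i f) := by
  have hdiff : Differentiable ℝ (fderiv ℝ f) :=
    (hf.fderiv_right (m := 1) (by norm_num)).differentiable one_ne_zero
  have key : ∀ (i j : Fin d) x, pd i (pd j f) x =
      fderiv ℝ (fderiv ℝ f) x (EuclideanSpace.single i 1) (EuclideanSpace.single j 1) := by
    intro i j x
    unfold pd
    rw [fderiv_clm_apply (hdiff x) (differentiableAt_const _)]
    simp
  funext x
  rw [key, key]
  exact (hf.contDiffAt.isSymmSndFDerivAt (by simp)) _ _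

lemma pd_iterate_comm {d : ℕ} {f : EuclideanSpace ℝ (Fin d) → ℝ} (i j : Fin d) (k : ℕ)
    (hf : ContDiff ℝ ((k + 1 : ℕ) : WithTop ℕ∞) f) :
    (pd i)^[k] (pd j f) = pd j ((pd i)^[k] f) := by
  induction k with
  | zero => rfl
  | succ k ih =>
    rw [Function.iterate_succ_apply', Function.iterate_succ_apply',
      ih (hf.of_nat_le (by omega)), pd_comm]
    exact contDiff_iterate_pd i k 2 (hf.of_nat_le (by omega))

lemma contDiff_foldr_pd {d : ℕ} (ζ : Fin d → ℕ) (l : List (Fin d)) (n : ℕ)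
    {f : EuclideanSpace ℝ (Fin d) → ℝ}
    (hf : ContDiff ℝ ((n + (l.map ζ).sum : ℕ) : WithTop ℕ∞) f) :
    ContDiff ℝ (n : WithTop ℕ∞) (l.foldr (fun i g => (pd i)^[ζ i] g) f) := by
  induction l generalizing n with
  | nil => simpa using hf
  | cons i l ih =>
    rw [List.foldr_cons]
    refine contDiff_iterate_pd i _ _ (ih _ (hf.of_nat_le ?_))
    simp [add_assoc]

lemma foldr_pd_add_single {d : ℕ} (ζ : Fin d → ℕ) (j : Fin d) (l : List (Fin d)) (hl : l.Nodup)
    (hj : j ∈ l) {f : EuclideanSpace ℝ (Fin d) → ℝ}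
    (hf : ContDiff ℝ (((l.map ζ).sum + 1 : ℕ) : WithTop ℕ∞) f) :
    l.foldr (fun i g => (pd i)^[(ζ + Pi.single j 1 : Fin d → ℕ) i] g) f =
      pd j (l.foldr (fun i g => (pd i)^[ζ i] g) f) := by
  induction l with
  | nil => simp at hj
  | cons i l ih =>
    rw [List.nodup_cons] at hl
    rw [List.foldr_cons, List.foldr_cons]
    by_cases hij : j = i
    · subst hij
      rw [← Function.iterate_succ_apply' (pd j)]
      have hcongr : l.foldr (fun i g => (pd i)^[(ζ + Pi.single j 1 : Fin d → ℕ) i] g) f =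
          l.foldr (fun i g => (pd i)^[ζ i] g) f := by
        refine List.foldr_ext _ _ _ fun a ha b => ?_
        have : a ≠ j := fun h => hl.1 (h ▸ ha)
        simp [this]
      rw [hcongr]
      simp
    · have hmem : j ∈ l := by simpa [hij] using hj
      have hcoord : (ζ + Pi.single j 1 : Fin d → ℕ) i = ζ i := by simp [Ne.symm hij]
      rw [hcoord, ih hl.2 hmem (hf.of_nat_le (by simp)), pd_iterate_comm]
      refine contDiff_foldr_pd ζ l _ (hf.of_nat_le ?_)
      simp only [List.map_cons, List.sum_cons]
      omega

lemma contDiff_mpd {d : ℕ} (ζ : Fin d → ℕ) (n : ℕ) {f : EuclideanSpace ℝ (Fin d) → ℝ}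
    (hf : ContDiff ℝ ((n + ∑ i, ζ i : ℕ) : WithTop ℕ∞) f) :
    ContDiff ℝ (n : WithTop ℕ∞) (mpd ζ f) := by
  refine contDiff_foldr_pd ζ _ n ?_
  rwa [Fin.sum_univ_def] at hf

lemma mpd_add_single {d : ℕ} (ζ : Fin d → ℕ) (j : Fin d) {f : EuclideanSpace ℝ (Fin d) → ℝ}
    (hf : ContDiff ℝ ((∑ i, ζ i + 1 : ℕ) : WithTop ℕ∞) f) :
    mpd (ζ + Pi.single j 1) f = pd j (mpd ζ f) := by
  refine foldr_pd_add_single ζ j _ (List.nodup_finRange d) (List.mem_finRange j) ?_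
  rwa [Fin.sum_univ_def] at hf

lemma mpd_zero {d : ℕ} (f : EuclideanSpace ℝ (Fin d) → ℝ) : mpd 0 f = f := by
  simp [mpd]

lemma mem_midx {d n : ℕ} {ζ : Fin d → ℕ} : ζ ∈ midx d n ↔ ∑ i, ζ i ≤ n := by
  unfold midx
  simp only [mem_filter, mem_image, mem_univ, true_and, and_iff_right_iff_imp]
  intro h
  refine ⟨fun i => ⟨ζ i, ?_⟩, rfl⟩
  have := Finset.single_le_sum (f := ζ) (fun i _ => Nat.zero_le _) (mem_univ i)
  omega

lemma sum_add_single {d : ℕ} (ζ : Fin d → ℕ) (j : Fin d) :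
    ∑ i, (ζ + Pi.single j 1 : Fin d → ℕ) i = ∑ i, ζ i + 1 := by
  simp [Finset.sum_add_distrib]

lemma hasCompactSupport_pd {d : ℕ} {f : EuclideanSpace ℝ (Fin d) → ℝ} (i : Fin d)
    (hf : HasCompactSupport f) : HasCompactSupport (pd i f) :=
  hf.fderiv_apply (𝕜 := ℝ) _

lemma hasCompactSupport_mpd {d : ℕ} (ζ : Fin d → ℕ) {f : EuclideanSpace ℝ (Fin d) → ℝ}
    (hf : HasCompactSupport f) : HasCompactSupport (mpd ζ f) := by
  unfold mpd
  induction List.finRange d with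
  | nil => exact hf
  | cons i l ih =>
    rw [List.foldr_cons]
    induction ζ i with
    | zero => exact ih
    | succ k ihk =>
      rw [Function.iterate_succ_apply']
      exact hasCompactSupport_pd i ihk

lemma fderiv_eq_sum_pd {d : ℕ} (f : EuclideanSpace ℝ (Fin d) → ℝ)
    (x v : EuclideanSpace ℝ (Fin d)) : fderiv ℝ f x v = ∑ i, v i * pd i f x := by
  have hv : v = ∑ i, v i • EuclideanSpace.single i (1 : ℝ) := by
    simpa using ((EuclideanSpace.basisFun (Fin d) ℝ).sum_repr v).symm
  conv_lhs => rw [hv]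
  simp [pd]

lemma fderiv_apply_coord {d : ℕ} {c : EuclideanSpace ℝ (Fin d) → EuclideanSpace ℝ (Fin d)}
    {x : EuclideanSpace ℝ (Fin d)} (hc : DifferentiableAt ℝ c x) (i : Fin d)
    (v : EuclideanSpace ℝ (Fin d)) :
    fderiv ℝ (fun y => c y i) x v = fderiv ℝ c x v i := by
  have := ((EuclideanSpace.proj (𝕜 := ℝ) i).hasFDerivAt.comp x hc.hasFDerivAt).fderiv
  exact congrArg (fun L => L v) this

lemma det_fderiv_add_smul {d : ℕ} {c : EuclideanSpace ℝ (Fin d) → EuclideanSpace ℝ (Fin d)}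
    {x : EuclideanSpace ℝ (Fin d)} (hc : DifferentiableAt ℝ c x) (θ : ℝ) :
    (ContinuousLinearMap.id ℝ (EuclideanSpace ℝ (Fin d)) + θ • fderiv ℝ c x).det =
      ((1 : Matrix (Fin d) (Fin d) ℝ) + θ • jac c x).det := by
  rw [ContinuousLinearMap.det,
    ← LinearMap.det_toMatrix (EuclideanSpace.basisFun (Fin d) ℝ).toBasis]
  congr 1
  ext i j
  simp [LinearMap.toMatrix_apply, jac, fderiv_apply_coord hc, Matrix.one_apply]

lemma norm_le_of_abs_le {d : ℕ} {v : EuclideanSpace ℝ (Fin d)} {ε : ℝ} (h : ∀ i, |v i| ≤ ε) :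
    ‖v‖ ≤ d * ε := by
  have hv : v = ∑ i, v i • EuclideanSpace.single i (1 : ℝ) := by
    simpa using ((EuclideanSpace.basisFun (Fin d) ℝ).sum_repr v).symm
  rw [hv]
  refine (norm_sum_le _ _).trans ?_
  calc ∑ i, ‖v i • EuclideanSpace.single i (1 : ℝ)‖ ≤ ∑ _i : Fin d, ε :=
        Finset.sum_le_sum fun i _ => by simpa [norm_smul] using h i
    _ = d * ε := by simp

/-- The family `(θ, x) ↦ (θ, x + θ c(x))`. -/
def homotopyMap {E : Type*} [AddCommGroup E] [Module ℝ E] (c : E → E) (p : ℝ × E) : ℝ × E :=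
  (p.1, p.2 + p.1 • c p.2)

lemma exists_strictFDerivAt_equiv_homotopyMap {E : Type*} [NormedAddCommGroup E]
    [NormedSpace ℝ E] [FiniteDimensional ℝ E] {c : E → E} (hc : ContDiff ℝ 1 c) (θ : ℝ) (x : E)
    (hdet : (ContinuousLinearMap.id ℝ E + θ • fderiv ℝ c x).det ≠ 0) :
    ∃ L : (ℝ × E) ≃L[ℝ] (ℝ × E),
      HasStrictFDerivAt (homotopyMap c) (L : (ℝ × E) →L[ℝ] (ℝ × E)) (θ, x) := by
  have hG : ContDiff ℝ 1 (homotopyMap c) := by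
    unfold homotopyMap
    fun_prop
  have hs := hG.contDiffAt.hasStrictFDerivAt (x := (θ, x)) one_ne_zero
  have hcx : HasFDerivAt c (fderiv ℝ c x) (θ, x).2 :=
    (hc.differentiable one_ne_zero x).hasFDerivAt
  have h1 : HasFDerivAt (Prod.fst : ℝ × E → ℝ) (ContinuousLinearMap.fst ℝ ℝ E) (θ, x) :=
    hasFDerivAt_fst
  have h2 : HasFDerivAt (Prod.snd : ℝ × E → E) (ContinuousLinearMap.snd ℝ ℝ E) (θ, x) :=
    hasFDerivAt_snd
  have hL := (h1.prodMk (h2.add (h1.smul (hcx.comp (θ, x) h2)))).fderiv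
  have hinj : Function.Injective (fderiv ℝ (homotopyMap c) (θ, x)).toLinearMap := by
    rw [← LinearMap.ker_eq_bot, LinearMap.ker_eq_bot']
    rintro ⟨s, v⟩ hsv
    have hsv' : fderiv ℝ (homotopyMap c) (θ, x) (s, v) = 0 := hsv
    have hrw := congrArg (fun L => L (s, v)) hL
    have hsv2 := hrw.symm.trans hsv'
    simp only [ContinuousLinearMap.prod_apply, Prod.mk_eq_zero] at hsv2
    obtain ⟨hs0, hv0⟩ := hsv2
    have hs0' : s = 0 := by simpa using hs0
    subst hs0'
    have hker : (ContinuousLinearMap.id ℝ E + θ • fderiv ℝ c x).toLinearMap v = 0 := by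
      simpa using hv0
    have := LinearMap.ker_eq_bot'.1 (by_contra fun h => hdet (LinearMap.det_eq_zero_iff_ker_ne_bot.2 h)) v hker
    simp [this]
  let e := (LinearEquiv.ofInjectiveEndo _ hinj).toContinuousLinearEquiv
  refine ⟨e, ?_⟩
  have he : (e : (ℝ × E) →L[ℝ] (ℝ × E)) = fderiv ℝ (homotopyMap c) (θ, x) := by
    ext p <;> rfl
  rw [he]
  exact hs

/-- A bounded `C¹` perturbation of the identity, all of whose scalings by `θ ∈ [0, 1]` are
local diffeomorphisms, is injective. -/
lemma injective_add_of_det_ne_zero {E : Type*} [NormedAddCommGroup E]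
    [NormedSpace ℝ E] [FiniteDimensional ℝ E] {c : E → E} (hc : ContDiff ℝ 1 c) {R : ℝ}
    (hR : ∀ x, ‖c x‖ ≤ R)
    (hdet : ∀ x, ∀ θ ∈ Set.Icc (0 : ℝ) 1,
      (ContinuousLinearMap.id ℝ E + θ • fderiv ℝ c x).det ≠ 0)
    {t : ℝ} (ht : t ∈ Set.Icc (0 : ℝ) 1) :
    Function.Injective (fun x => x + t • c x) := by
  have hcc : Continuous c := hc.continuous
  have hnear : ∀ θ ∈ Set.Icc (0 : ℝ) 1, ∀ x y, x + θ • c x = y → x ∈ Metric.closedBall y R := by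
    rintro θ ⟨h0, h1⟩ x y rfl
    rw [Metric.mem_closedBall, dist_eq_norm, sub_add_cancel_left, norm_neg, norm_smul,
      Real.norm_of_nonneg h0]
    nlinarith [hR x, norm_nonneg (c x)]
  intro x₀ x₁ h01
  by_contra hne
  set y := x₁ + t • c x₁ with hy
  let Q : Set (ℝ × E × E) :=
    {p | p.1 ∈ Set.Icc (0 : ℝ) 1 ∧ p.2.1 + p.1 • c p.2.1 = y ∧ p.2.2 + p.1 • c p.2.2 = y}
  have hQclosed : IsClosed Q := by
    refine IsClosed.inter (isClosed_Icc.preimage continuous_fst) (IsClosed.inter ?_ ?_)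
    · exact isClosed_eq (by fun_prop) continuous_const
    · exact isClosed_eq (by fun_prop) continuous_const
  have hQcompact : IsCompact Q := by
    refine IsCompact.of_isClosed_subset
      ((isCompact_Icc (a := (0 : ℝ)) (b := 1)).prod ((isCompact_closedBall y R).prod (isCompact_closedBall y R)))
      hQclosed ?_
    rintro ⟨θ, a, b⟩ ⟨hθ, ha, hb⟩
    exact ⟨hθ, hnear θ hθ a y ha, hnear θ hθ b y hb⟩
  let P : Set (ℝ × E × E) := Q ∩ {p | p.2.1 ≠ p.2.2}
  have hPclosed : IsClosed P := by
    rw [isClosed_iff_frequently]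
    rintro ⟨θ, a, b⟩ hfreq
    have hmem : (θ, a, b) ∈ Q :=
      isClosed_iff_frequently.1 hQclosed _ (hfreq.mono fun _ h => h.1)
    refine ⟨hmem, ?_⟩
    rintro (rfl : a = b)
    obtain ⟨L, hL⟩ := exists_strictFDerivAt_equiv_homotopyMap hc θ a (hdet a θ hmem.1)
    let e := hL.toOpenPartialHomeomorph (homotopyMap c)
    have hsrc : e.source ∈ nhds (θ, a) :=
      e.open_source.mem_nhds hL.mem_toOpenPartialHomeomorph_source
    have hfst : Filter.Tendsto (fun p : ℝ × E × E => (p.1, p.2.1)) (nhds (θ, a, a))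
        (nhds (θ, a)) :=
      Continuous.tendsto (f := fun p : ℝ × E × E => (p.1, p.2.1)) (by fun_prop) (θ, a, a)
    have hsnd : Filter.Tendsto (fun p : ℝ × E × E => (p.1, p.2.2)) (nhds (θ, a, a))
        (nhds (θ, a)) :=
      Continuous.tendsto (f := fun p : ℝ × E × E => (p.1, p.2.2)) (by fun_prop) (θ, a, a)
    refine hfreq ?_
    filter_upwards [hfst hsrc, hsnd hsrc] with p hp1 hp2 hpP
    have heq : homotopyMap c (p.1, p.2.1) = homotopyMap c (p.1, p.2.2) := by
      simp only [homotopyMap]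
      rw [hpP.1.2.1, hpP.1.2.2]
    have := e.injOn hp1 hp2 heq
    exact hpP.2 (Prod.ext_iff.1 this).2
  have hPcompact : IsCompact P := hQcompact.of_isClosed_subset hPclosed Set.inter_subset_left
  obtain ⟨⟨θ, a, b⟩, hP, hmin⟩ := hPcompact.exists_isMinOn
    ⟨(t, x₀, x₁), ⟨ht, h01, rfl⟩, hne⟩ continuous_fst.continuousOn
  obtain ⟨⟨hθ, ha, hb⟩, hab⟩ := hP
  simp only at hθ ha hb
  have hab' : a ≠ b := hab
  have hθ0 : 0 < θ := by
    refine lt_of_le_of_ne hθ.1 ?_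
    rintro rfl
    simp only [zero_smul, add_zero] at ha hb
    exact hab' (ha.trans hb.symm)
  have hpersist : ∀ z, z + θ • c z = y → ∀ U ∈ nhds z,
      ∀ᶠ s in nhds θ, ∃ w ∈ U, w + s • c w = y := by
    intro z hz U hU
    obtain ⟨L, hL⟩ := exists_strictFDerivAt_equiv_homotopyMap hc θ z (hdet z θ hθ)
    have hmap := hL.map_nhds_eq_of_equiv
    have hGz : homotopyMap c (θ, z) = (θ, y) := by simp [homotopyMap, hz]
    have himg : homotopyMap c '' (Prod.snd ⁻¹' U) ∈ nhds (θ, y) := by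
      rw [← hGz, ← hmap]
      exact Filter.image_mem_map (continuous_snd.continuousAt.preimage_mem_nhds hU)
    have htend : Filter.Tendsto (fun s : ℝ => (s, y)) (nhds θ) (nhds (θ, y)) :=
      Continuous.tendsto (by fun_prop) θ
    filter_upwards [htend himg] with s hs
    obtain ⟨⟨s', w⟩, hw, hws⟩ := hs
    simp only [homotopyMap, Prod.mk.injEq] at hws
    obtain ⟨rfl, hws⟩ := hws
    exact ⟨w, hw, hws⟩
  obtain ⟨U, V, hU, hV, haU, hbV, hUV⟩ := t2_separation hab'
  have hev := ((hpersist a ha U (hU.mem_nhds haU)).and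
    (hpersist b hb V (hV.mem_nhds hbV))).and (lt_mem_nhds hθ0)
  obtain ⟨s, ⟨⟨⟨a', ha'U, ha'⟩, ⟨b', hb'V, hb'⟩⟩, hs0⟩, hsθ⟩ :=
    ((hev.filter_mono nhdsWithin_le_nhds).and (self_mem_nhdsWithin (s := Set.Iio θ))).exists
  have hle : θ ≤ s := hmin (a := (s, a', b'))
    ⟨⟨⟨hs0.le, (le_of_lt hsθ).trans hθ.2⟩, ha', hb'⟩,
      fun h => Set.disjoint_left.1 hUV ha'U (by rw [show a' = b' from h]; exact hb'V)⟩
  exact absurd hsθ (not_lt.2 hle)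

/-- Change of variables for a bounded perturbation of the identity with Jacobian bounded below. -/
lemma lintegral_comp_add_smul_le {E : Type*} [NormedAddCommGroup E]
    [NormedSpace ℝ E] [FiniteDimensional ℝ E] [MeasurableSpace E] [BorelSpace E]
    (μ : Measure E) [μ.IsAddHaarMeasure] {c : E → E} (hc : ContDiff ℝ 1 c)
    {R K : ℝ} (hK : 0 < K) (hR : ∀ x, ‖c x‖ ≤ R)
    (hdet : ∀ x, ∀ θ ∈ Set.Icc (0 : ℝ) 1,
      K⁻¹ ≤ |(ContinuousLinearMap.id ℝ E + θ • fderiv ℝ c x).det|)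
    {t : ℝ} (ht : t ∈ Set.Icc (0 : ℝ) 1) (g : E → ENNReal) :
    ∫⁻ x, g (x + t • c x) ∂μ ≤ ENNReal.ofReal K * ∫⁻ x, g x ∂μ := by
  have hinj := injective_add_of_det_ne_zero hc hR
    (fun x θ hθ => abs_pos.1 (lt_of_lt_of_le (inv_pos.2 hK) (hdet x θ hθ))) ht
  have hderiv : ∀ x ∈ Set.univ, HasFDerivWithinAt (fun x => x + t • c x)
      (ContinuousLinearMap.id ℝ E + t • fderiv ℝ c x) Set.univ x := fun x _ =>
    ((hasFDerivAt_id x).add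
      ((hc.differentiable one_ne_zero x).hasFDerivAt.const_smul t)).hasFDerivWithinAt
  have hcv := lintegral_image_eq_lintegral_abs_det_fderiv_mul μ MeasurableSet.univ hderiv
    hinj.injOn g
  calc ∫⁻ x, g (x + t • c x) ∂μ
      ≤ ∫⁻ x, ENNReal.ofReal K *
          (ENNReal.ofReal |(ContinuousLinearMap.id ℝ E + t • fderiv ℝ c x).det| *
            g (x + t • c x)) ∂μ := by
        refine lintegral_mono fun x => ?_
        rw [← mul_assoc, ← ENNReal.ofReal_mul hK.le]
        refine le_mul_of_one_le_left (zero_le) ?_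
        rw [← ENNReal.ofReal_one]
        refine ENNReal.ofReal_le_ofReal ?_
        have := mul_le_mul_of_nonneg_left (hdet x t ht) hK.le
        rwa [mul_inv_cancel₀ hK.ne'] at this
    _ = ENNReal.ofReal K * ∫⁻ x in (fun x => x + t • c x) '' Set.univ, g x ∂μ := by
        rw [hcv, lintegral_const_mul' _ _ ENNReal.ofReal_ne_top, Measure.restrict_univ]
    _ ≤ ENNReal.ofReal K * ∫⁻ x, g x ∂μ := by
        gcongr
        exact Measure.restrict_le_self

lemma sq_intervalIntegral_le {h : ℝ → ℝ} (hh : Continuous h) :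
    (∫ θ in (0 : ℝ)..1, h θ) ^ 2 ≤ ∫ θ in (0 : ℝ)..1, h θ ^ 2 := by
  set I := ∫ θ in (0 : ℝ)..1, h θ with hI
  have h1 : ∫ θ in (0 : ℝ)..1, (2 * I * h θ - I ^ 2) = I ^ 2 := by
    rw [intervalIntegral.integral_sub ((hh.const_mul _).intervalIntegrable _ _)
      intervalIntegrable_const, intervalIntegral.integral_const_mul, ← hI]
    simp
    ring
  rw [← h1]
  refine intervalIntegral.integral_mono_on zero_le_one
    (Continuous.intervalIntegrable (by fun_prop) _ _)
    (Continuous.intervalIntegrable (by fun_prop) _ _) fun θ _ => ?_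
  nlinarith [sq_nonneg (h θ - I)]

lemma sq_sub_le_integral_sum_sq_pd {d : ℕ} {v : EuclideanSpace ℝ (Fin d) → ℝ}
    (hv : ContDiff ℝ 1 v) {ε : ℝ} (x w : EuclideanSpace ℝ (Fin d)) (hw : ∀ i, |w i| ≤ ε) :
    (v (x + w) - v x) ^ 2 ≤
      ∫ θ in (0 : ℝ)..1, d * ε ^ 2 * ∑ i, pd i v (x + θ • w) ^ 2 := by
  have hpd : ∀ i, Continuous (pd i v) := fun i => by
    have := contDiff_pd (n := 0) i (f := v) (by simpa using hv)
    exact this.continuous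
  have hderiv : ∀ θ ∈ Set.uIcc (0 : ℝ) 1, HasDerivAt (fun θ : ℝ => v (x + θ • w))
      (∑ i, w i * pd i v (x + θ • w)) θ := by
    intro θ _
    have h1 : HasDerivAt (fun θ : ℝ => x + θ • w) w θ := by
      simpa using ((hasDerivAt_id θ).smul_const w).const_add x
    rw [← fderiv_eq_sum_pd]
    exact ((hv.differentiable one_ne_zero (x + θ • w)).hasFDerivAt).comp_hasDerivAt θ h1
  have hcont : Continuous fun θ : ℝ => ∑ i, w i * pd i v (x + θ • w) := by fun_prop
  have hftc := intervalIntegral.integral_eq_sub_of_hasDerivAt hderiv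
    (hcont.intervalIntegrable _ _)
  simp only [one_smul, zero_smul, add_zero] at hftc
  rw [← hftc]
  refine (sq_intervalIntegral_le hcont).trans ?_
  refine intervalIntegral.integral_mono_on zero_le_one
    (Continuous.intervalIntegrable (by fun_prop) _ _)
    (Continuous.intervalIntegrable (by fun_prop) _ _) fun θ _ => ?_
  refine (sq_sum_le_card_mul_sum_sq).trans ?_
  rw [card_univ, Fintype.card_fin, mul_assoc]
  refine mul_le_mul_of_nonneg_left ?_ (Nat.cast_nonneg _)
  rw [mul_sum]
  refine Finset.sum_le_sum fun i _ => ?_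
  rw [mul_pow]
  exact mul_le_mul_of_nonneg_right (sq_le_sq' (abs_le.1 (hw i)).1 (abs_le.1 (hw i)).2)
    (sq_nonneg _)

lemma lintegral_sq_sub_le {d : ℕ} {c : EuclideanSpace ℝ (Fin d) → EuclideanSpace ℝ (Fin d)}
    (hc : ContDiff ℝ 1 c) {ε K : ℝ} (hK : 0 < K) (hcε : ∀ x i, |c x i| ≤ ε)
    (hdet : ∀ x, ∀ θ ∈ Set.Icc (0 : ℝ) 1,
      K⁻¹ ≤ |(ContinuousLinearMap.id ℝ _ + θ • fderiv ℝ c x).det|)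
    {v : EuclideanSpace ℝ (Fin d) → ℝ} (hv : ContDiff ℝ 1 v) :
    ∫⁻ x, ENNReal.ofReal ((v (x + c x) - v x) ^ 2) ≤
      ENNReal.ofReal K * ∫⁻ x, ENNReal.ofReal (d * ε ^ 2 * ∑ i, pd i v x ^ 2) := by
  have hcc := hc.continuous
  have hpd : ∀ i, Continuous (pd i v) := fun i => by
    have := contDiff_pd (n := 0) i (f := v) (by simpa using hv)
    exact this.continuous
  set g : EuclideanSpace ℝ (Fin d) → ℝ≥0∞ :=
    fun x => ENNReal.ofReal (d * ε ^ 2 * ∑ i, pd i v x ^ 2) with hg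
  calc ∫⁻ x, ENNReal.ofReal ((v (x + c x) - v x) ^ 2)
      ≤ ∫⁻ x, ∫⁻ θ in Set.Ioc (0 : ℝ) 1, g (x + θ • c x) := by
        refine lintegral_mono fun x => ?_
        have hcont : Continuous fun θ : ℝ => d * ε ^ 2 * ∑ i, pd i v (x + θ • c x) ^ 2 := by
          fun_prop
        refine (ENNReal.ofReal_le_ofReal
          (sq_sub_le_integral_sum_sq_pd hv x (c x) (hcε x))).trans ?_
        rw [intervalIntegral.integral_of_le zero_le_one, ofReal_integral_eq_lintegral_ofReal]
        · exact (hcont.intervalIntegrable 0 1).1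
        · exact Filter.Eventually.of_forall fun θ => by positivity
    _ = ∫⁻ θ in Set.Ioc (0 : ℝ) 1, ∫⁻ x, g (x + θ • c x) := by
        refine lintegral_lintegral_swap ?_
        have : Continuous fun p : EuclideanSpace ℝ (Fin d) × ℝ => g (p.1 + p.2 • c p.1) := by
          refine ENNReal.continuous_ofReal.comp ?_
          fun_prop
        exact this.measurable.aemeasurable
    _ ≤ ∫⁻ θ in Set.Ioc (0 : ℝ) 1, ENNReal.ofReal K * ∫⁻ x, g x := by
        refine setLIntegral_mono' measurableSet_Ioc fun θ hθ => ?_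
        exact lintegral_comp_add_smul_le volume hc hK (fun x => norm_le_of_abs_le (hcε x)) hdet
          ⟨hθ.1.le, hθ.2⟩ g
    _ = ENNReal.ofReal K * ∫⁻ x, g x := by simp

/-- `f` is `n` times differentiable with all partial derivatives up to order `n` bounded by `C`. -/
def PdBound {d : ℕ} (n : ℕ) (C : ℝ) (f : EuclideanSpace ℝ (Fin d) → ℝ) : Prop :=
  match n with
  | 0 => ∀ x, |f x| ≤ C
  | n + 1 => (∀ x, |f x| ≤ C) ∧ Differentiable ℝ f ∧ ∀ i, PdBound n C (pd i f)

namespace PdBound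

variable {d : ℕ} {n : ℕ} {A B : ℝ} {f g : EuclideanSpace ℝ (Fin d) → ℝ}

lemma abs_le (hf : PdBound n A f) (x : EuclideanSpace ℝ (Fin d)) : |f x| ≤ A := by
  cases n with
  | zero => exact hf x
  | succ n => exact hf.1 x

lemma nonneg (hf : PdBound n A f) : 0 ≤ A := (abs_nonneg _).trans (hf.abs_le 0)

lemma mono (hf : PdBound n A f) (h : A ≤ B) : PdBound n B f := by
  induction n generalizing f with
  | zero => exact fun x => (hf x).trans h
  | succ n ih => exact ⟨fun x => (hf.1 x).trans h, hf.2.1, fun i => ih (hf.2.2 i)⟩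

lemma of_succ (hf : PdBound (n + 1) A f) : PdBound n A f := by
  induction n generalizing f with
  | zero => exact hf.1
  | succ n ih => exact ⟨hf.1, hf.2.1, fun i => ih (hf.2.2 i)⟩

lemma add (hf : PdBound n A f) (hg : PdBound n B g) : PdBound n (A + B) (f + g) := by
  induction n generalizing f g with
  | zero => exact fun x => (abs_add_le _ _).trans (add_le_add (hf x) (hg x))
  | succ n ih =>
    refine ⟨fun x => (abs_add_le _ _).trans (add_le_add (hf.1 x) (hg.1 x)),
      hf.2.1.add hg.2.1, fun i => ?_⟩
    have : pd i (f + g) = pd i f + pd i g := by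
      funext x
      simp [pd, fderiv_add (hf.2.1 x) (hg.2.1 x)]
    rw [this]
    exact ih (hf.2.2 i) (hg.2.2 i)

lemma mul (hf : PdBound n A f) (hg : PdBound n B g) : PdBound n (2 ^ n * (A * B)) (f * g) := by
  have hbound : ∀ x, |(f * g) x| ≤ A * B := fun x => by
    rw [Pi.mul_apply, abs_mul]
    exact mul_le_mul (hf.abs_le x) (hg.abs_le x) (abs_nonneg _) hf.nonneg
  have hAB : 0 ≤ A * B := mul_nonneg hf.nonneg hg.nonneg
  induction n generalizing f g with
  | zero => simpa [PdBound] using hbound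
  | succ n ih =>
    refine ⟨fun x => (hbound x).trans (le_mul_of_one_le_left hAB (one_le_pow₀ one_le_two)),
      hf.2.1.mul hg.2.1, fun i => ?_⟩
    have hrule : pd i (f * g) = f * pd i g + g * pd i f := by
      funext x
      simp [pd, fderiv_mul (hf.2.1 x) (hg.2.1 x)]
    have hprod : ∀ {f g : EuclideanSpace ℝ (Fin d) → ℝ}, PdBound n A f → PdBound n B g →
        ∀ x, |(f * g) x| ≤ A * B := fun hf hg x => by
      rw [Pi.mul_apply, abs_mul]
      exact mul_le_mul (hf.abs_le x) (hg.abs_le x) (abs_nonneg _) hf.nonneg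
    have h1 := ih hf.of_succ (hg.2.2 i) (hprod hf.of_succ (hg.2.2 i))
    have h2 := ih (hf.2.2 i) hg.of_succ (hprod (hf.2.2 i) hg.of_succ)
    rw [hrule, mul_comm g]
    convert h1.add h2 using 1
    ring

end PdBound

lemma pdBound_mpd {d m : ℕ} {ε : ℝ} {f : EuclideanSpace ℝ (Fin d) → ℝ}
    (hf : ContDiff ℝ (m : WithTop ℕ∞) f)
    (hbound : ∀ γ : Fin d → ℕ, (∑ i, γ i) ≤ m → ∀ x, |mpd γ f x| ≤ ε) (n : ℕ)
    (γ : Fin d → ℕ) (hγ : n + ∑ i, γ i ≤ m) : PdBound n ε (mpd γ f) := by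
  induction n generalizing γ with
  | zero => exact hbound γ (by omega)
  | succ n ih =>
    refine ⟨hbound γ (by omega), ?_, fun i => ?_⟩
    · exact (contDiff_mpd γ 1 (hf.of_nat_le (by omega))).differentiable (by simp)
    · rw [← mpd_add_single γ i (hf.of_nat_le (by omega))]
      exact ih _ (by rw [sum_add_single]; omega)

lemma pd_comp_add {d : ℕ} {c : EuclideanSpace ℝ (Fin d) → EuclideanSpace ℝ (Fin d)}
    {v : EuclideanSpace ℝ (Fin d) → ℝ} (hc : Differentiable ℝ c) (hv : Differentiable ℝ v)
    (j : Fin d) (x : EuclideanSpace ℝ (Fin d)) :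
    pd j (fun y => v (y + c y)) x =
      pd j v (x + c x) + ∑ i, pd j (fun y => c y i) x * pd i v (x + c x) := by
  have h1 : HasFDerivAt (fun y => v (y + c y))
      ((fderiv ℝ v (x + c x)).comp (ContinuousLinearMap.id ℝ _ + fderiv ℝ c x)) x :=
    HasFDerivAt.comp x (hv (x + c x)).hasFDerivAt
      ((hasFDerivAt_id x).add (hc x).hasFDerivAt)
  have h2 : ∀ i, pd j (fun y => c y i) x = fderiv ℝ c x (EuclideanSpace.single j 1) i :=
    fun i => fderiv_apply_coord (hc x) i _
  simp only [h2]
  rw [← fderiv_eq_sum_pd, pd, h1.fderiv]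
  simp [pd]

lemma pd_mpd_comp_add {d m : ℕ}
    {c : EuclideanSpace ℝ (Fin d) → EuclideanSpace ℝ (Fin d)}
    {u : EuclideanSpace ℝ (Fin d) → ℝ} (hc : ContDiff ℝ 1 c) (hu : ContDiff ℝ ((m + 1 : ℕ) : WithTop ℕ∞) u)
    {ζ : Fin d → ℕ} (hζ : ∑ i, ζ i ≤ m) (j : Fin d) (x : EuclideanSpace ℝ (Fin d)) :
    pd j (fun y => mpd ζ u (y + c y)) x = mpd (ζ + Pi.single j 1) u (x + c x) +
      ∑ i, pd j (fun y => c y i) x * mpd (ζ + Pi.single i 1) u (x + c x) := by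
  have hv : ContDiff ℝ ((1 : ℕ) : WithTop ℕ∞) (mpd ζ u) :=
    contDiff_mpd ζ 1 (hu.of_nat_le (by omega))
  rw [pd_comp_add (hc.differentiable one_ne_zero) (hv.differentiable (by simp))]
  simp_rw [mpd_add_single ζ _ (hu.of_nat_le (by omega))]

/-- Finite sums of terms `a(x) ∂^ζ u(x + c(x))` with `|ζ| + n ≤ m`, where the coefficients `a` are
bounded together with their derivatives up to order `n`, with total bound `A`. -/
inductive IsRemainder {d : ℕ} (c : EuclideanSpace ℝ (Fin d) → EuclideanSpace ℝ (Fin d))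
    (u : EuclideanSpace ℝ (Fin d) → ℝ) (m n : ℕ) :
    ℝ → (EuclideanSpace ℝ (Fin d) → ℝ) → Prop
  | zero : IsRemainder c u m n 0 0
  | term {A : ℝ} {a : EuclideanSpace ℝ (Fin d) → ℝ} {ζ : Fin d → ℕ} (ha : PdBound n A a)
      (hζ : ∑ i, ζ i + n ≤ m) : IsRemainder c u m n A (fun x => a x * mpd ζ u (x + c x))
  | add {A B : ℝ} {f g : EuclideanSpace ℝ (Fin d) → ℝ} (hf : IsRemainder c u m n A f)
      (hg : IsRemainder c u m n B g) : IsRemainder c u m n (A + B) (f + g)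

namespace IsRemainder

variable {d : ℕ} {c : EuclideanSpace ℝ (Fin d) → EuclideanSpace ℝ (Fin d)}
  {u : EuclideanSpace ℝ (Fin d) → ℝ} {m n : ℕ}

lemma sum {ι : Type*} (s : Finset ι) {A : ℝ} {f : ι → EuclideanSpace ℝ (Fin d) → ℝ}
    (hf : ∀ i ∈ s, IsRemainder c u m n A (f i)) :
    IsRemainder c u m n (s.card * A) (∑ i ∈ s, f i) := by
  classical
  induction s using Finset.induction_on with
  | empty => simpa using zero
  | insert i s hi ih =>
    rw [sum_insert hi, card_insert_of_notMem hi]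
    convert (hf i (mem_insert_self i s)).add (ih fun j hj => hf j (mem_insert_of_mem hj)) using 1
    push_cast
    ring

lemma abs_le {A : ℝ} {f : EuclideanSpace ℝ (Fin d) → ℝ} (hf : IsRemainder c u m n A f)
    (x : EuclideanSpace ℝ (Fin d)) : |f x| ≤ A * ∑ ζ ∈ midx d m, |mpd ζ u (x + c x)| := by
  induction hf with
  | zero => simp
  | @term A a ζ ha hζ =>
    rw [abs_mul]
    refine mul_le_mul (ha.abs_le x) ?_ (abs_nonneg _) ha.nonneg
    exact single_le_sum (f := fun ζ => |mpd ζ u (x + c x)|) (fun _ _ => abs_nonneg _)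
      (mem_midx.2 (by omega))
  | add _ _ ih1 ih2 =>
    rw [add_mul]
    exact (abs_add_le _ _).trans (add_le_add ih1 ih2)

lemma differentiable_and_pd (hc : ContDiff ℝ 1 c) (hu : ContDiff ℝ ((m + 1 : ℕ) : WithTop ℕ∞) u) {ε K : ℝ}
    (hεK : ε ≤ K) (hcb : ∀ i j, PdBound n ε (pd j fun y => c y i)) (j : Fin d) {A : ℝ}
    {f : EuclideanSpace ℝ (Fin d) → ℝ} (hf : IsRemainder c u m (n + 1) A f) :
    Differentiable ℝ f ∧ IsRemainder c u m n (A * (2 + d * 2 ^ n * K)) (pd j f) := by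
  induction hf with
  | zero =>
    refine ⟨differentiable_const _, ?_⟩
    have : pd j (0 : EuclideanSpace ℝ (Fin d) → ℝ) = 0 := by
      funext x
      simp [pd]
    rw [this, zero_mul]
    exact zero
  | @term A a ζ ha hζ =>
    have hv : ContDiff ℝ ((1 : ℕ) : WithTop ℕ∞) (mpd ζ u) :=
      contDiff_mpd ζ 1 (hu.of_nat_le (by omega))
    have hdv : Differentiable ℝ fun y => mpd ζ u (y + c y) :=
      (hv.differentiable (by simp)).comp
        (differentiable_id.add (hc.differentiable one_ne_zero))
    refine ⟨ha.2.1.mul hdv, ?_⟩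
    have hrule : pd j (fun y => a y * mpd ζ u (y + c y)) =
        (fun x => pd j a x * mpd ζ u (x + c x)) +
        ((fun x => a x * mpd (ζ + Pi.single j 1) u (x + c x)) +
        ∑ i, fun x => (a * pd j fun y => c y i) x * mpd (ζ + Pi.single i 1) u (x + c x)) := by
      funext x
      have hmul : pd j (fun y => a y * mpd ζ u (y + c y)) x =
          a x * pd j (fun y => mpd ζ u (y + c y)) x + mpd ζ u (x + c x) * pd j a x := by
        simp only [pd]
        rw [fderiv_fun_mul (ha.2.1 x) (hdv x)]
        simp
      rw [hmul, pd_mpd_comp_add hc hu (by omega)]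
      simp only [Pi.add_apply, Finset.sum_apply, Pi.mul_apply, mul_add, mul_sum, mul_assoc]
      ring
    rw [hrule]
    have hA := ha.nonneg
    have hlast := IsRemainder.sum (c := c) (u := u) (m := m) (n := n) (univ : Finset (Fin d))
      (A := 2 ^ n * (A * K))
      (f := fun i x => (a * pd j fun y => c y i) x * mpd (ζ + Pi.single i 1) u (x + c x))
      fun i _ => term ((ha.of_succ.mul (hcb i j)).mono (by gcongr))
        (by rw [sum_add_single]; omega)
    convert (term (c := c) (u := u) (ha.2.2 j) (ζ := ζ) (by omega)).add
      ((term (ζ := ζ + Pi.single j 1) ha.of_succ (by rw [sum_add_single]; omega)).add hlast)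
      using 1
    simp only [card_univ, Fintype.card_fin]
    ring
  | @add A B f g _ _ ih1 ih2 =>
    refine ⟨ih1.1.add ih2.1, ?_⟩
    have : pd j (f + g) = pd j f + pd j g := by
      funext x
      simp [pd, fderiv_add (ih1.1 x) (ih2.1 x)]
    rw [this, add_mul]
    exact ih1.2.add ih2.2

end IsRemainder

lemma exists_isRemainder (d m : ℕ) (hm : 1 ≤ m) (K : ℝ) (k n : ℕ) (hkn : k + n = m) :
    ∃ C : ℝ, ∀ ε : ℝ, ε ≤ K →
      ∀ c : EuclideanSpace ℝ (Fin d) → EuclideanSpace ℝ (Fin d),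
        ContDiff ℝ (m : WithTop ℕ∞) c →
        (∀ γ : Fin d → ℕ, (∑ i, γ i) ≤ m → ∀ i x, |mpd γ (fun y => c y i) x| ≤ ε) →
        ∀ u : EuclideanSpace ℝ (Fin d) → ℝ, ContDiff ℝ ((m + 1 : ℕ) : WithTop ℕ∞) u →
          ∀ α : Fin d → ℕ, ∑ i, α i = k →
            IsRemainder c u m n (C * ε) (fun x =>
              mpd α (fun y => u (y + c y) - u y) x - (mpd α u (x + c x) - mpd α u x)) := by
  induction k generalizing n with
  | zero =>
    refine ⟨0, fun ε _ c _ _ u _ α hα => ?_⟩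
    have hα0 : α = 0 := by
      funext i
      simpa using (Finset.sum_eq_zero_iff.1 hα) i (mem_univ i)
    subst hα0
    simp only [mpd_zero, sub_self, zero_mul]
    exact IsRemainder.zero
  | succ k ih =>
    obtain ⟨C, hC⟩ := ih (n + 1) (by omega)
    refine ⟨C * (2 + d * 2 ^ n * K) + d, fun ε hεK c hc hcb u hu α hα => ?_⟩
    have hc1 : ContDiff ℝ 1 c := hc.of_le (by exact_mod_cast hm)
    have hci : ∀ i, ContDiff ℝ (m : WithTop ℕ∞) fun y => c y i := fun i => by fun_prop
    obtain ⟨j, hj⟩ : ∃ j, α j ≠ 0 := by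
      by_contra! h
      simp [h] at hα
    obtain ⟨β, rfl⟩ : ∃ β : Fin d → ℕ, α = β + Pi.single j 1 := by
      refine ⟨α - Pi.single j 1, (tsub_add_cancel_of_le ?_).symm⟩
      intro i
      rcases eq_or_ne i j with rfl | hij
      · simpa using Nat.one_le_iff_ne_zero.2 hj
      · simp [hij]
    rw [sum_add_single] at hα
    have hβ : ∑ i, β i = k := by omega
    have hpdc : ∀ i l, PdBound n ε (pd l fun y => c y i) := fun i l => by
      have h := pdBound_mpd (hci i) (fun γ hγ x => hcb γ hγ i x) n (0 + Pi.single l 1)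
        (by rw [sum_add_single]; simp; omega)
      rwa [mpd_add_single 0 l ((hci i).of_nat_le (by simpa using hm)), mpd_zero] at h
    obtain ⟨-, hpdR⟩ := (hC ε hεK c hc hcb u hu β hβ).differentiable_and_pd hc1 hu hεK hpdc j
    have hsum := IsRemainder.sum (c := c) (u := u) (m := m) (n := n) (univ : Finset (Fin d))
      (A := ε)
      (f := fun i x => (pd j fun y => c y i) x * mpd (β + Pi.single i 1) u (x + c x))
      fun i _ => IsRemainder.term (hpdc i j) (by rw [sum_add_single]; omega)
    have hw : ContDiff ℝ (m : WithTop ℕ∞) fun y => u (y + c y) - u y :=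
      ((hu.of_nat_le (Nat.le_succ m)).comp (contDiff_id.add hc)).sub
        (hu.of_nat_le (Nat.le_succ m))
    have hdw : Differentiable ℝ (mpd β fun y => u (y + c y) - u y) :=
      (contDiff_mpd β 1 (hw.of_nat_le (by omega))).differentiable (by simp)
    have hdu : Differentiable ℝ (mpd β u) :=
      (contDiff_mpd β 1 (hu.of_nat_le (by omega))).differentiable (by simp)
    have hduc : Differentiable ℝ fun y => mpd β u (y + c y) :=
      hdu.comp (differentiable_id.add (hc1.differentiable one_ne_zero))
    convert hpdR.add hsum using 1
    · simp only [card_univ, Fintype.card_fin]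
      ring
    · funext x
      have hpd : pd j (fun x => mpd β (fun y => u (y + c y) - u y) x -
          (mpd β u (x + c x) - mpd β u x)) x =
          pd j (mpd β fun y => u (y + c y) - u y) x -
            (pd j (fun y => mpd β u (y + c y)) x - pd j (mpd β u) x) := by
        have h := ((hdw x).hasFDerivAt.sub
          ((hduc x).hasFDerivAt.sub (hdu x).hasFDerivAt)).fderiv
        exact congrArg (fun L => L (EuclideanSpace.single j 1)) h
      rw [Pi.add_apply, hpd, pd_mpd_comp_add hc1 hu (by omega),
        ← mpd_add_single β j (hw.of_nat_le (by omega)),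
        ← mpd_add_single β j (hu.of_nat_le (by omega)), Finset.sum_apply]
      ring

lemma IsRemainder.sq_le {d : ℕ} {c : EuclideanSpace ℝ (Fin d) → EuclideanSpace ℝ (Fin d)}
    {u : EuclideanSpace ℝ (Fin d) → ℝ} {m n : ℕ} {A : ℝ} {f : EuclideanSpace ℝ (Fin d) → ℝ}
    (hf : IsRemainder c u m n A f) (x : EuclideanSpace ℝ (Fin d)) :
    f x ^ 2 ≤ A ^ 2 * ((midx d m).card * ∑ ζ ∈ midx d m, mpd ζ u (x + c x) ^ 2) := by
  calc f x ^ 2 = |f x| ^ 2 := (sq_abs _).symm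
    _ ≤ (A * ∑ ζ ∈ midx d m, |mpd ζ u (x + c x)|) ^ 2 :=
        pow_le_pow_left₀ (abs_nonneg _) (hf.abs_le x) 2
    _ = A ^ 2 * (∑ ζ ∈ midx d m, |mpd ζ u (x + c x)|) ^ 2 := mul_pow _ _ _
    _ ≤ _ := by
        refine mul_le_mul_of_nonneg_left ?_ (sq_nonneg A)
        have h := sq_sum_le_card_mul_sum_sq (s := midx d m)
          (f := fun ζ => |mpd ζ u (x + c x)|)
        simp_rw [sq_abs] at h
        exact h

lemma integrable_mpd_sq {d m : ℕ} {u : EuclideanSpace ℝ (Fin d) → ℝ}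
    (hu : ContDiff ℝ (m : WithTop ℕ∞) u) (hsupp : HasCompactSupport u) {ζ : Fin d → ℕ}
    (hζ : ∑ i, ζ i ≤ m) : Integrable fun x => mpd ζ u x ^ 2 := by
  have hcont : Continuous (mpd ζ u) :=
    (contDiff_mpd ζ 0 (hu.of_nat_le (by omega))).continuous
  have hcs : HasCompactSupport ((fun t : ℝ => t ^ 2) ∘ mpd ζ u) :=
    (hasCompactSupport_mpd ζ hsupp).comp_left (by simp)
  exact ((continuous_pow 2).comp hcont).integrable_of_hasCompactSupport hcs

lemma lintegral_mul_sum_sq_le {d m : ℕ} {u : EuclideanSpace ℝ (Fin d) → ℝ}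
    (hu : ContDiff ℝ (m : WithTop ℕ∞) u) (hsupp : HasCompactSupport u) {ι : Type*}
    (s : Finset ι) (ζ : ι → Fin d → ℕ) (hζ : ∀ i ∈ s, ∑ j, ζ i j ≤ m) {B : ℝ} (hB : 0 ≤ B) :
    ∫⁻ x, ENNReal.ofReal (B * ∑ i ∈ s, mpd (ζ i) u x ^ 2) ≤
      ENNReal.ofReal (B * (s.card * ∑ ξ ∈ midx d m, ∫ x, mpd ξ u x ^ 2)) := by
  have hint := fun i hi => integrable_mpd_sq hu hsupp (hζ i hi)
  rw [← ofReal_integral_eq_lintegral_ofReal ((integrable_finsetSum s hint).const_mul B)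
    (Filter.Eventually.of_forall fun x => by positivity), integral_const_mul,
    integral_finsetSum s hint]
  refine ENNReal.ofReal_le_ofReal (mul_le_mul_of_nonneg_left ?_ hB)
  rw [← nsmul_eq_mul]
  refine Finset.sum_le_card_nsmul _ _ _ fun i hi => ?_
  exact single_le_sum (f := fun ξ => ∫ x, mpd ξ u x ^ 2)
    (fun ξ _ => integral_nonneg fun x => sq_nonneg _) (mem_midx.2 (hζ i hi))

lemma integral_sq_le_of_isRemainder {d m n : ℕ} {K ε C : ℝ} (hK : 0 < K)
    {c : EuclideanSpace ℝ (Fin d) → EuclideanSpace ℝ (Fin d)} (hc : ContDiff ℝ 1 c)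
    (hcε : ∀ x i, |c x i| ≤ ε)
    (hdet : ∀ x, ∀ θ ∈ Set.Icc (0 : ℝ) 1,
      K⁻¹ ≤ |(ContinuousLinearMap.id ℝ _ + θ • fderiv ℝ c x).det|)
    {u : EuclideanSpace ℝ (Fin d) → ℝ} (hu : ContDiff ℝ ((m + 1 : ℕ) : WithTop ℕ∞) u)
    (hsupp : HasCompactSupport u) {α : Fin d → ℕ} (hα : ∑ i, α i ≤ m)
    {f : EuclideanSpace ℝ (Fin d) → ℝ}
    (hf : IsRemainder c u m n (C * ε) fun x => f x - (mpd α u (x + c x) - mpd α u x)) :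
    ∫ x, f x ^ 2 ≤ (2 * K * d ^ 2 + 2 * K * C ^ 2 * (midx d m).card ^ 2) * ε ^ 2 *
      ∑ ζ ∈ midx d (m + 1), ∫ x, mpd ζ u x ^ 2 := by
  set S := ∑ ζ ∈ midx d (m + 1), ∫ x, mpd ζ u x ^ 2
  have hS0 : 0 ≤ S := sum_nonneg fun ζ _ => integral_nonneg fun x => sq_nonneg _
  set M : ℝ := ((midx d m).card : ℝ)
  have hv : ContDiff ℝ ((1 : ℕ) : WithTop ℕ∞) (mpd α u) :=
    contDiff_mpd α 1 (hu.of_nat_le (by omega))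
  have hvc := hv.continuous
  have hcc := hc.continuous
  by_cases hint : Integrable fun x => f x ^ 2
  swap
  · rw [integral_undef hint]
    positivity
  have hpoint : ∀ x, f x ^ 2 ≤ 2 * (mpd α u (x + c x) - mpd α u x) ^ 2 +
      2 * (C * ε) ^ 2 * M * ∑ ζ ∈ midx d m, mpd ζ u (x + c x) ^ 2 := by
    intro x
    have h1 := hf.sq_le x
    nlinarith [sq_nonneg (f x - 2 * (mpd α u (x + c x) - mpd α u x))]
  have hdiff := lintegral_sq_sub_le hc hK hcε hdet (v := mpd α u) (by simpa using hv)
  simp_rw [← fun i => mpd_add_single α i (f := u) (hu.of_nat_le (by omega))] at hdiff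
  have h1 : ∫⁻ x, ENNReal.ofReal (d * ε ^ 2 * ∑ i, mpd (α + Pi.single i 1) u x ^ 2) ≤
      ENNReal.ofReal (d * ε ^ 2 * (d * S)) := by
    simpa using lintegral_mul_sum_sq_le hu hsupp (univ : Finset (Fin d))
      (fun i => α + Pi.single i 1) (fun i _ => by rw [sum_add_single]; omega)
      (B := d * ε ^ 2) (by positivity)
  have h2 : ∫⁻ x, ENNReal.ofReal (2 * (C * ε) ^ 2 * M * ∑ ζ ∈ midx d m, mpd ζ u x ^ 2) ≤
      ENNReal.ofReal (2 * (C * ε) ^ 2 * M * (M * S)) :=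
    lintegral_mul_sum_sq_le hu hsupp (midx d m) id
      (fun ζ hζ => (mem_midx.1 hζ).trans (Nat.le_succ m)) (by positivity)
  have h3 := lintegral_comp_add_smul_le volume hc hK (fun x => norm_le_of_abs_le (hcε x)) hdet
    (t := 1) (by simp)
    fun x => ENNReal.ofReal (2 * (C * ε) ^ 2 * M * ∑ ζ ∈ midx d m, mpd ζ u x ^ 2)
  simp only [one_smul] at h3
  rw [← ENNReal.ofReal_le_ofReal_iff (by positivity),
    ofReal_integral_eq_lintegral_ofReal hint (Filter.Eventually.of_forall fun x => sq_nonneg _)]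
  calc ∫⁻ x, ENNReal.ofReal (f x ^ 2)
      ≤ ∫⁻ x, (ENNReal.ofReal 2 * ENNReal.ofReal ((mpd α u (x + c x) - mpd α u x) ^ 2) +
          ENNReal.ofReal
            (2 * (C * ε) ^ 2 * M * ∑ ζ ∈ midx d m, mpd ζ u (x + c x) ^ 2)) := by
        refine lintegral_mono fun x => ?_
        rw [← ENNReal.ofReal_mul zero_le_two,
          ← ENNReal.ofReal_add (by positivity) (by positivity)]
        exact ENNReal.ofReal_le_ofReal (hpoint x)
    _ = ENNReal.ofReal 2 * (∫⁻ x, ENNReal.ofReal ((mpd α u (x + c x) - mpd α u x) ^ 2)) +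
          ∫⁻ x, ENNReal.ofReal
            (2 * (C * ε) ^ 2 * M * ∑ ζ ∈ midx d m, mpd ζ u (x + c x) ^ 2) := by
        rw [lintegral_add_left, lintegral_const_mul' _ _ ENNReal.ofReal_ne_top]
        exact Measurable.const_mul (Continuous.measurable
          (ENNReal.continuous_ofReal.comp (by fun_prop))) _
    _ ≤ ENNReal.ofReal 2 * (ENNReal.ofReal K * ENNReal.ofReal (d * ε ^ 2 * (d * S))) +
          ENNReal.ofReal K * ENNReal.ofReal (2 * (C * ε) ^ 2 * M * (M * S)) := by
        gcongr
        · exact hdiff.trans (by gcongr)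
        · exact h3.trans (by gcongr)
    _ = _ := by
        rw [← ENNReal.ofReal_mul hK.le, ← ENNReal.ofReal_mul zero_le_two,
          ← ENNReal.ofReal_mul hK.le, ← ENNReal.ofReal_add (by positivity) (by positivity)]
        congr 1
        ring

/-- `L₂` estimate for the difference operator: there is `N = N(m,d,K)` such that
`Σ_{|α| ≤ m} ∫ |∂^α(u(x + c(x)) − u(x))|² dx ≤ N ε² Σ_{|ζ| ≤ m+1} ∫ |∂^ζ u|² dx`. -/
theorem degenerate_SIDE_stmt7 (d m : ℕ) (hd : 1 ≤ d) (hm : 1 ≤ m) (K : ℝ) (hK : 0 < K) :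
    ∃ N : ℝ, ∀ ε : ℝ, 0 < ε → ε ≤ K →
      ∀ c : EuclideanSpace ℝ (Fin d) → EuclideanSpace ℝ (Fin d),
        ContDiff ℝ (m : ℕ∞) c →
        (∀ γ : Fin d → ℕ, (∑ i, γ i) ≤ m →
          ∀ (i : Fin d) (x : EuclideanSpace ℝ (Fin d)), |mpd γ (fun y => c y i) x| ≤ ε) →
        (∀ (x : EuclideanSpace ℝ (Fin d)), ∀ θ ∈ Set.Icc (0 : ℝ) 1,
          K⁻¹ ≤ |((1 : Matrix (Fin d) (Fin d) ℝ) + θ • jac c x).det|) →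
        ∀ u : EuclideanSpace ℝ (Fin d) → ℝ,
          ContDiff ℝ ((m : ℕ∞) + 1) u → HasCompactSupport u →
          ∑ α ∈ midx d m, (∫ x, |mpd α (fun y => u (y + c y) - u y) x| ^ 2) ≤
            N * ε ^ 2 * ∑ ζ ∈ midx d (m + 1), ∫ x, |mpd ζ u x| ^ 2 := by
  choose C hC using fun k (hk : k ≤ m) => exists_isRemainder d m hm K k (m - k) (by omega)
  refine ⟨∑ α ∈ (midx d m).attach, (2 * K * d ^ 2 +
    2 * K * C (∑ i, α.1 i) (mem_midx.1 α.2) ^ 2 * (midx d m).card ^ 2),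
    fun ε _ hεK c hc hcb hdet u hu hsupp => ?_⟩
  have hc' : ContDiff ℝ (m : WithTop ℕ∞) c := by exact_mod_cast hc
  have hu' : ContDiff ℝ ((m + 1 : ℕ) : WithTop ℕ∞) u := by exact_mod_cast hu
  have hc1 : ContDiff ℝ 1 c := hc'.of_le (by exact_mod_cast hm)
  simp_rw [sq_abs]
  rw [← sum_attach (midx d m), sum_mul, sum_mul]
  refine sum_le_sum fun α _ => ?_
  refine integral_sq_le_of_isRemainder hK hc1 (fun x i => ?_) (fun x θ hθ => ?_) hu' hsupp
    (mem_midx.1 α.2) (hC _ _ ε hεK c hc' hcb u hu' α.1 rfl)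
  · simpa [mpd_zero] using hcb 0 (by simp) i x
  · rw [det_fderiv_add_smul (hc1.differentiable one_ne_zero x)]
    exact hdet x θ hθ
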